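/- arXiv:1706.04381 — 2 statements merged into one kernel-verified Lean document; each statement's English description precedes it below -/
import Mathlib

section
/- Let f : ℝ^p → ℝ be differentiable, L-smooth and m-strongly convex with 0 ≤ m ≤ L, and let α > 0. Then for all x, y ∈ ℝ^p, f(x) − f(y − α∇f(y)) ≥ ⟨∇f(y), x − y⟩ + (m/2)‖x − y‖² + (α/2)(2 − Lα)‖∇f(y)‖². -/
open RealInnerProductSpace

/-- The descent lemma: a differentiable function with `L`-Lipschitz gradient lies below its
quadratic upper model. -/
theorem le_add_inner_gradient_add_sq {E : Type*} [NormedAddCommGroup E] [InnerProductSpace ℝ E]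
    [CompleteSpace E] {f : E → ℝ} {L : ℝ} (hf : Differentiable ℝ f)
    (hsmooth : ∀ x y, ‖gradient f x - gradient f y‖ ≤ L * ‖x - y‖) (z v : E) :
    f (z + v) ≤ f z + ⟪gradient f z, v⟫ + L / 2 * ‖v‖ ^ 2 := by
  have hderiv (t : ℝ) : HasDerivAt
      (fun t : ℝ => f (z + t • v) - t * ⟪gradient f z, v⟫ - L / 2 * ‖v‖ ^ 2 * t ^ 2)
      (⟪gradient f (z + t • v) - gradient f z, v⟫ - L * ‖v‖ ^ 2 * t) t := by
    have hline : HasDerivAt (fun t : ℝ => z + t • v) v t := by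
      simpa using ((hasDerivAt_id t).smul_const v).const_add z
    have hcomp := (hf (z + t • v)).hasGradientAt.hasFDerivAt.comp_hasDerivAt t hline
    rw [InnerProductSpace.toDual_apply_apply] at hcomp
    refine ((hcomp.sub ((hasDerivAt_id t).mul_const ⟪gradient f z, v⟫)).sub
      ((hasDerivAt_pow 2 t).const_mul (L / 2 * ‖v‖ ^ 2))).congr_deriv ?_
    rw [inner_sub_left]
    push_cast
    ring
  have hanti : AntitoneOn
      (fun t : ℝ => f (z + t • v) - t * ⟪gradient f z, v⟫ - L / 2 * ‖v‖ ^ 2 * t ^ 2)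
      (Set.Icc 0 1) := by
    refine antitoneOn_of_deriv_nonpos (convex_Icc 0 1)
      (fun t _ => (hderiv t).continuousAt.continuousWithinAt)
      (fun t _ => (hderiv t).differentiableAt.differentiableWithinAt) fun t ht => ?_
    rw [interior_Icc] at ht
    rw [(hderiv t).deriv, sub_nonpos]
    calc ⟪gradient f (z + t • v) - gradient f z, v⟫
        ≤ ‖gradient f (z + t • v) - gradient f z‖ * ‖v‖ := real_inner_le_norm _ _
      _ ≤ L * ‖z + t • v - z‖ * ‖v‖ := by gcongr; exact hsmooth _ _
      _ = L * ‖v‖ ^ 2 * t := by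
        rw [add_sub_cancel_left, norm_smul, Real.norm_of_nonneg ht.1.le]
        ring
  have h := hanti (Set.left_mem_Icc.2 zero_le_one) (Set.right_mem_Icc.2 zero_le_one) zero_le_one
  simp only [one_smul, zero_smul, add_zero] at h
  linarith

/-- Key intermediate inequality (S3)/(S4) in the proof of Lemma 3:
`f(x) − f(y − α∇f(y)) ≥ ⟨∇f(y), x − y⟩ + (m/2)‖x − y‖² + (α/2)(2 − Lα)‖∇f(y)‖²`. -/
theorem key_descent_inequality {p : ℕ} (f : EuclideanSpace ℝ (Fin p) → ℝ)
    (L m : ℝ) (hm : 0 ≤ m) (hmL : m ≤ L)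
    (hf : Differentiable ℝ f)
    (hsmooth : ∀ x y, ‖gradient f x - gradient f y‖ ≤ L * ‖x - y‖)
    (hsc : ∀ x y, f x ≥ f y + ⟪gradient f y, x - y⟫ + m / 2 * ‖x - y‖ ^ 2)
    (α : ℝ) (hα : 0 < α) :
    ∀ x y, f x - f (y - α • gradient f y) ≥
      ⟪gradient f y, x - y⟫ + m / 2 * ‖x - y‖ ^ 2
        + α / 2 * (2 - L * α) * ‖gradient f y‖ ^ 2 := by
  intro x y
  have h := le_add_inner_gradient_add_sq hf hsmooth y (-(α • gradient f y))
  rw [← sub_eq_add_neg, inner_neg_right, real_inner_smul_right, real_inner_self_eq_norm_sq,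
    norm_neg, norm_smul, Real.norm_of_nonneg hα.le] at h
  linarith [hsc x y]
end

section
/- Let f : ℝ^p → ℝ be differentiable, L-smooth and m-strongly convex with 0 < m ≤ L, let x⋆ be the unique point with ∇f(x⋆) = 0, and let α, β, η ∈ ℝ with δ = β − η. Given x_k, x_{k−1} ∈ ℝ^p, set y_k = (1+η)x_k − ηx_{k−1}, x_{k+1} = (1+β)x_k − βx_{k−1} − α∇f(y_k), and d = x_k − x_{k−1}. Then (1/2)·( −Lδ²‖d‖² − 2(1 − Lα)δ⟨∇f(y_k), d⟩ + α(2 − Lα)‖∇f(y_k)‖² + mη²‖d‖² − 2η⟨∇f(y_k), d⟩ ) ≤ f(x_k) − f(x_{k+1}). -/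
open RealInnerProductSpace

/-- Descent lemma: a differentiable function with `L`-Lipschitz gradient lies below the quadratic
model of curvature `L` at every point. -/
theorem le_quadratic_of_lipschitz_gradient {E : Type*} [NormedAddCommGroup E]
    [InnerProductSpace ℝ E] [CompleteSpace E] {f : E → ℝ} {L : ℝ} (hf : Differentiable ℝ f)
    (hsmooth : ∀ x y, ‖gradient f x - gradient f y‖ ≤ L * ‖x - y‖) (y v : E) :
    f (y + v) ≤ f y + ⟪gradient f y, v⟫ + L / 2 * ‖v‖ ^ 2 := by
  have hderiv (t : ℝ) : HasDerivAt
      (fun t : ℝ ↦ f (y + t • v) - t * ⟪gradient f y, v⟫ - L / 2 * ‖v‖ ^ 2 * t ^ 2)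
      (⟪gradient f (y + t • v), v⟫ - ⟪gradient f y, v⟫ - L * ‖v‖ ^ 2 * t) t := by
    have hline : HasDerivAt (fun t : ℝ ↦ y + t • v) v t := by
      simpa using ((hasDerivAt_id t).smul_const v).const_add y
    have hcomp := (hf (y + t • v)).hasGradientAt.hasFDerivAt.comp_hasDerivAt t hline
    have h := (hcomp.sub ((hasDerivAt_id t).mul_const ⟪gradient f y, v⟫)).sub
      (((hasDerivAt_id t).pow 2).const_mul (L / 2 * ‖v‖ ^ 2))
    refine h.congr_deriv ?_
    simp only [InnerProductSpace.toDual_apply_apply, id_eq]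
    ring
  have hanti := antitoneOn_of_deriv_nonpos (convex_Icc (0 : ℝ) 1)
    (fun t _ ↦ (hderiv t).continuousAt.continuousWithinAt)
    (fun t _ ↦ (hderiv t).differentiableAt.differentiableWithinAt)
    (fun t ht ↦ by
      rw [(hderiv t).deriv, ← inner_sub_left]
      rw [interior_Icc] at ht
      have hlip := hsmooth (y + t • v) y
      rw [add_sub_cancel_left, norm_smul, Real.norm_of_nonneg ht.1.le] at hlip
      have hcs := real_inner_le_norm (gradient f (y + t • v) - gradient f y) v
      have hmul := mul_le_mul_of_nonneg_right hlip (norm_nonneg v)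
      linarith)
  have h := hanti (Set.left_mem_Icc.2 zero_le_one) (Set.right_mem_Icc.2 zero_le_one) zero_le_one
  simp only [one_smul, zero_smul, add_zero] at h
  linarith

/-- First inequality (weight matrix `X₁ + X₂`) of Lemma 5 for the general accelerated method
`x_{k+1} = (1+β)x_k − βx_{k−1} − α∇f(y_k)`, `y_k = (1+η)x_k − ηx_{k−1}`. -/
theorem general_accelerated_supply_rate_X1X2 {p : ℕ} (f : EuclideanSpace ℝ (Fin p) → ℝ)
    (L m : ℝ) (hm : 0 < m) (hmL : m ≤ L)
    (hf : Differentiable ℝ f)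
    (hsmooth : ∀ x y, ‖gradient f x - gradient f y‖ ≤ L * ‖x - y‖)
    (hsc : ∀ x y, f x ≥ f y + ⟪gradient f y, x - y⟫ + m / 2 * ‖x - y‖ ^ 2)
    (xs : EuclideanSpace ℝ (Fin p)) (hxs : gradient f xs = 0)
    (α β η δ : ℝ) (hδ : δ = β - η)
    (xk xkm1 yk xkp1 d : EuclideanSpace ℝ (Fin p))
    (hy : yk = (1 + η) • xk - η • xkm1)
    (hx : xkp1 = (1 + β) • xk - β • xkm1 - α • gradient f yk)
    (hd : d = xk - xkm1) :
    1 / 2 * (-(L * δ ^ 2) * ‖d‖ ^ 2 - 2 * (1 - L * α) * δ * ⟪gradient f yk, d⟫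
        + α * (2 - L * α) * ‖gradient f yk‖ ^ 2
        + m * η ^ 2 * ‖d‖ ^ 2 - 2 * η * ⟪gradient f yk, d⟫) ≤ f xk - f xkp1 := by
  have hlower := hsc xk yk
  have hupper := le_quadratic_of_lipschitz_gradient hf hsmooth yk (δ • d - α • gradient f yk)
  have hk : xk - yk = -(η • d) := by rw [hy, hd]; module
  have hstep : yk + (δ • d - α • gradient f yk) = xkp1 := by
    rw [hx, hδ, hd]
    generalize gradient f yk = g
    rw [hy]
    module
  rw [hk, norm_neg, norm_smul, mul_pow, Real.norm_eq_abs, sq_abs, inner_neg_right,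
    real_inner_smul_right] at hlower
  rw [hstep, norm_sub_sq_real, inner_sub_right, real_inner_smul_right, real_inner_smul_right,
    real_inner_smul_left, real_inner_smul_right, norm_smul, norm_smul, mul_pow, mul_pow,
    Real.norm_eq_abs, Real.norm_eq_abs, sq_abs, sq_abs, real_inner_self_eq_norm_sq,
    real_inner_comm (gradient f yk) d] at hupper
  linarith
end
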